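/- arXiv:1801.07525 — 4 statements merged into one kernel-verified Lean document; each statement's English description precedes it below -/
import Mathlib

section
/- Let I be a real interval, f : I → ℝ a C² function with nowhere vanishing first derivative whose second derivative f″ is Lipschitz on I with Lipschitz constant L, and assume ‖f″/f′‖_∞ ≤ 1. Then for every n ∈ ℕ and every a ∈ Iⁿ, |R_f(a)| ≤ (L/(2|f′(ā)|))·δ(a)·Var(a). -/
/-- Arithmetic mean of a finite vector of reals. -/
noncomputable def amean {n : ℕ} (a : Fin n → ℝ) : ℝ := (∑ i, a i) / n

/-- Variance of a finite vector of reals. -/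
noncomputable def varV {n : ℕ} (a : Fin n → ℝ) : ℝ := (∑ i, (a i - amean a) ^ 2) / n

/-- Spread (max - min) of a finite vector of reals. -/
noncomputable def deltaV {n : ℕ} (a : Fin n → ℝ) : ℝ := sSup (Set.range a) - sInf (Set.range a)

/-- The remainder term `R_f(a)` (Taylor remainder form). -/
noncomputable def Rf (f f' f'' : ℝ → ℝ) {n : ℕ} (a : Fin n → ℝ) : ℝ :=
  (1 / (n * f' (amean a))) *
    ∑ i, (f (a i) - f (amean a) - f' (amean a) * (a i - amean a)
          - (1 / 2) * f'' (amean a) * (a i - amean a) ^ 2)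

/-- The remainder term `S_f`, where `m` is the arithmetic mean of the vector and
`Q` is the quasi-arithmetic mean `QA_f(a)`. -/
noncomputable def Sf (f f' f'' : ℝ → ℝ) (m Q : ℝ) : ℝ :=
  ∫ u in m..Q, (f u - f Q) * f'' u / (f' u) ^ 2

/-- The star norm `‖g‖_* = sup_{p,q ∈ I} |∫_p^q g|`. -/
noncomputable def starNorm (g : ℝ → ℝ) (I : Set ℝ) : ℝ :=
  sSup {x | ∃ p ∈ I, ∃ q ∈ I, x = |∫ t in p..q, g t|}

/-- The first-order Taylor remainder of a function with `L`-Lipschitz derivative. -/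
theorem abs_sub_sub_mul_le_of_lipschitz_deriv {I : Set ℝ} (hI : I.OrdConnected)
    {g g' : ℝ → ℝ} {L : ℝ} (hL : 0 ≤ L) (hg : ∀ x ∈ I, HasDerivAt g (g' x) x)
    (hLip : ∀ x ∈ I, ∀ y ∈ I, |g' x - g' y| ≤ L * |x - y|)
    {m x : ℝ} (hm : m ∈ I) (hx : x ∈ I) :
    |g x - g m - g' m * (x - m)| ≤ L * |x - m| ^ 2 := by
  have hsub : Set.uIcc m x ⊆ I := hI.uIcc_subset hm hx
  have hderiv : ∀ y ∈ Set.uIcc m x,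
      HasDerivWithinAt (fun y => g y - g' m * y) (g' y - g' m) (Set.uIcc m x) y := by
    intro y hy
    have := (hg y (hsub hy)).sub ((hasDerivAt_id y).const_mul (g' m))
    exact (this.congr_deriv (by ring)).hasDerivWithinAt
  have hbound : ∀ y ∈ Set.uIcc m x, ‖g' y - g' m‖ ≤ L * |x - m| := by
    intro y hy
    exact (hLip y (hsub hy) m hm).trans
      (mul_le_mul_of_nonneg_left (Set.abs_sub_left_of_mem_uIcc hy) hL)
  have := (convex_uIcc m x).norm_image_sub_le_of_norm_hasDerivWithin_le hderiv hbound
    Set.left_mem_uIcc Set.right_mem_uIcc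
  rw [Real.norm_eq_abs, Real.norm_eq_abs] at this
  calc |g x - g m - g' m * (x - m)| = |g x - g' m * x - (g m - g' m * m)| := by ring_nf
    _ ≤ L * |x - m| * |x - m| := this
    _ = L * |x - m| ^ 2 := by ring

/-- The second-order Taylor remainder of a function with `L`-Lipschitz second derivative. -/
theorem abs_taylor_two_remainder_le_of_lipschitz {I : Set ℝ} (hI : I.OrdConnected)
    {f f' f'' : ℝ → ℝ} {L : ℝ} (hL : 0 ≤ L)
    (hd1 : ∀ x ∈ I, HasDerivAt f (f' x) x) (hd2 : ∀ x ∈ I, HasDerivAt f' (f'' x) x)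
    (hLip : ∀ x ∈ I, ∀ y ∈ I, |f'' x - f'' y| ≤ L * |x - y|)
    {m x : ℝ} (hm : m ∈ I) (hx : x ∈ I) :
    |f x - f m - f' m * (x - m) - (1 / 2) * f'' m * (x - m) ^ 2| ≤ L / 2 * |x - m| ^ 3 := by
  set r : ℝ → ℝ := fun y => f y - f m - f' m * (y - m) - (1 / 2) * f'' m * (y - m) ^ 2 with hr
  set r' : ℝ → ℝ := fun y => f' y - f' m - f'' m * (y - m) with hr'
  have hrm : r m = 0 := by simp [hr]
  have hrd : ∀ y ∈ I, HasDerivAt r (r' y) y := by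
    intro y hy
    have hid : HasDerivAt (fun y : ℝ => y - m) 1 y := (hasDerivAt_id y).sub_const m
    have := (((hd1 y hy).sub_const (f m)).sub (hid.const_mul (f' m))).sub
      ((hid.pow 2).const_mul ((1 / 2) * f'' m))
    refine this.congr_deriv ?_
    simp only [hr']
    push_cast
    ring
  have hqd : ∀ y : ℝ, HasDerivAt (fun y : ℝ => (y - m) ^ 2) (2 * (y - m)) y := by
    intro y
    exact (((hasDerivAt_id y).sub_const m).pow 2).congr_deriv (by simp)
  have hrc : ContinuousOn r I := fun y hy => (hrd y hy).continuousAt.continuousWithinAt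
  have hqc : Continuous (fun y : ℝ => (y - m) ^ 2) := by fun_prop
  obtain rfl | hne := eq_or_ne x m
  · change |r x| ≤ _
    simp [hrm]
  have hsub : Set.uIcc m x ⊆ I := hI.uIcc_subset hm hx
  obtain ⟨c, hc, hcm, hratio⟩ :
      ∃ c ∈ Set.uIcc m x, c ≠ m ∧ (x - m) ^ 2 * r' c = r x * (2 * (c - m)) := by
    rcases hne.lt_or_gt with h | h
    · rw [Set.uIcc_of_ge h.le] at hsub ⊢
      obtain ⟨c, hc, e⟩ := exists_ratio_hasDerivAt_eq_ratio_slope r r' h (hrc.mono hsub)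
        (fun y hy => hrd y (hsub (Set.Ioo_subset_Icc_self hy))) _ _ hqc.continuousOn
        (fun y _ => hqd y)
      refine ⟨c, Set.Ioo_subset_Icc_self hc, hc.2.ne, ?_⟩
      rw [hrm] at e
      linear_combination -e
    · rw [Set.uIcc_of_le h.le] at hsub ⊢
      obtain ⟨c, hc, e⟩ := exists_ratio_hasDerivAt_eq_ratio_slope r r' h (hrc.mono hsub)
        (fun y hy => hrd y (hsub (Set.Ioo_subset_Icc_self hy))) _ _ hqc.continuousOn
        (fun y _ => hqd y)
      refine ⟨c, Set.Ioo_subset_Icc_self hc, hc.1.ne', ?_⟩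
      rw [hrm] at e
      linear_combination e
  have hr'c : |r' c| ≤ L * |c - m| ^ 2 :=
    abs_sub_sub_mul_le_of_lipschitz_deriv hI hL hd2 hLip hm (hsub hc)
  have hcpos : 0 < |c - m| := abs_pos.mpr (sub_ne_zero.mpr hcm)
  have hcx : |c - m| ≤ |x - m| := Set.abs_sub_left_of_mem_uIcc hc
  have habs : |x - m| ^ 2 * |r' c| = |r x| * (2 * |c - m|) := by
    have := congrArg abs hratio
    rwa [abs_mul, abs_mul, abs_mul, abs_pow, abs_two] at this
  change |r x| ≤ _
  refine le_of_mul_le_mul_right ?_ (mul_pos two_pos hcpos)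
  calc |r x| * (2 * |c - m|) = |x - m| ^ 2 * |r' c| := habs.symm
    _ ≤ |x - m| ^ 2 * (L * |c - m| ^ 2) := by gcongr
    _ = L * |x - m| ^ 2 * |c - m| * |c - m| := by ring
    _ ≤ L * |x - m| ^ 2 * |x - m| * |c - m| := by gcongr
    _ = L / 2 * |x - m| ^ 3 * (2 * |c - m|) := by ring

theorem amean_mem_Icc {n : ℕ} (hn : 0 < n) (a : Fin n → ℝ) :
    amean a ∈ Set.Icc (sInf (Set.range a)) (sSup (Set.range a)) := by
  have hn' : (0 : ℝ) < n := Nat.cast_pos.mpr hn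
  have hfin := Set.finite_range a
  have hlo := Finset.card_nsmul_le_sum Finset.univ a _
    fun i _ => csInf_le hfin.bddBelow (Set.mem_range_self i)
  have hhi := Finset.sum_le_card_nsmul Finset.univ a _
    fun i _ => le_csSup hfin.bddAbove (Set.mem_range_self i)
  simp only [Finset.card_univ, Fintype.card_fin, nsmul_eq_mul] at hlo hhi
  constructor
  · rw [amean, le_div_iff₀ hn']
    linarith
  · rw [amean, div_le_iff₀ hn']
    linarith

theorem abs_sub_amean_le_deltaV {n : ℕ} (hn : 0 < n) (a : Fin n → ℝ) (i : Fin n) :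
    |a i - amean a| ≤ deltaV a := by
  have hfin := Set.finite_range a
  obtain ⟨hlo, hhi⟩ := amean_mem_Icc hn a
  have h1 := csInf_le hfin.bddBelow (Set.mem_range_self i)
  have h2 := le_csSup hfin.bddAbove (Set.mem_range_self i)
  rw [deltaV, abs_le]
  constructor <;> linarith

theorem amean_mem_of_ordConnected {I : Set ℝ} (hI : I.OrdConnected) {n : ℕ} (hn : 0 < n)
    {a : Fin n → ℝ} (ha : ∀ i, a i ∈ I) : amean a ∈ I := by
  have hfin := Set.finite_range a
  have hne : (Set.range a).Nonempty := ⟨a ⟨0, hn⟩, Set.mem_range_self _⟩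
  have hrange : Set.range a ⊆ I := Set.range_subset_iff.mpr ha
  exact hI.out (hrange (hne.csInf_mem hfin)) (hrange (hne.csSup_mem hfin)) (amean_mem_Icc hn a)

theorem Rf_bound_of_lipschitz
    (I : Set ℝ) (hI : I.OrdConnected)
    (f f' f'' : ℝ → ℝ) (L : ℝ) (hL : 0 ≤ L)
    (hd1 : ∀ x ∈ I, HasDerivAt f (f' x) x)
    (hd2 : ∀ x ∈ I, HasDerivAt f' (f'' x) x)
    (hc : ContinuousOn f'' I)
    (hne : ∀ x ∈ I, f' x ≠ 0)
    (hLip : ∀ x ∈ I, ∀ y ∈ I, |f'' x - f'' y| ≤ L * |x - y|)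
    (hAP : ∀ x ∈ I, |f'' x / f' x| ≤ 1)
    (n : ℕ) (hn : 0 < n) (a : Fin n → ℝ) (ha : ∀ i, a i ∈ I) :
    |Rf f f' f'' a| ≤ L / (2 * |f' (amean a)|) * deltaV a * varV a := by
  have hn' : (0 : ℝ) < n := Nat.cast_pos.mpr hn
  have hm : amean a ∈ I := amean_mem_of_ordConnected hI hn ha
  have hf' : 0 < |f' (amean a)| := abs_pos.mpr (hne _ hm)
  have hsum : |∑ i, (f (a i) - f (amean a) - f' (amean a) * (a i - amean a)
      - (1 / 2) * f'' (amean a) * (a i - amean a) ^ 2)|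
      ≤ L / 2 * deltaV a * ∑ i, (a i - amean a) ^ 2 := by
    rw [Finset.mul_sum]
    refine (Finset.abs_sum_le_sum_abs _ _).trans (Finset.sum_le_sum fun i _ => ?_)
    calc _ ≤ L / 2 * |a i - amean a| ^ 3 :=
          abs_taylor_two_remainder_le_of_lipschitz hI hL hd1 hd2 hLip hm (ha i)
      _ = L / 2 * |a i - amean a| * (a i - amean a) ^ 2 := by
          rw [← sq_abs (a i - amean a)]
          ring
      _ ≤ L / 2 * deltaV a * (a i - amean a) ^ 2 := by
          gcongr
          exact abs_sub_amean_le_deltaV hn a i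
  rw [Rf, abs_mul, abs_div, abs_mul, abs_one, abs_of_pos hn', varV]
  calc _ ≤ 1 / (n * |f' (amean a)|) * (L / 2 * deltaV a * ∑ i, (a i - amean a) ^ 2) := by
        gcongr
    _ = _ := by
        field_simp
end

section
/- Let I be a real interval, f : I → ℝ a C² function with nowhere vanishing first derivative such that ‖f″/f′‖_∞ ≤ 1. Then for every n ∈ ℕ and every a ∈ Iⁿ, |QA_f(a) − ā| ≤ (α/2)·δ(a)², where α := (3+7e)/3. -/
/-- A function on an interval whose derivative has the sign of `x - q` is minimal at `q`. -/
lemma le_of_hasDerivAt_mul_sub_nonneg {I : Set ℝ} (hI : I.OrdConnected) {h h' : ℝ → ℝ}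
    (hd : ∀ x ∈ I, HasDerivAt h (h' x) x) {q x : ℝ} (hq : q ∈ I) (hx : x ∈ I)
    (hs : ∀ c ∈ I, 0 ≤ h' c * (c - q)) : h q ≤ h x := by
  rcases lt_trichotomy q x with hlt | rfl | hlt
  · have hsub : Set.Icc q x ⊆ I := hI.out hq hx
    obtain ⟨c, hc, he⟩ := exists_hasDerivAt_eq_slope h h' hlt
      (fun y hy => (hd y (hsub hy)).continuousAt.continuousWithinAt)
      (fun y hy => hd y (hsub (Set.Ioo_subset_Icc_self hy)))
    have h0 : 0 ≤ h' c := nonneg_of_mul_nonneg_left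
      (hs c (hsub (Set.Ioo_subset_Icc_self hc))) (sub_pos.2 hc.1)
    rw [eq_div_iff (sub_pos.2 hlt).ne'] at he
    nlinarith [mul_nonneg h0 (sub_pos.2 hlt).le]
  · exact le_rfl
  · have hsub : Set.Icc x q ⊆ I := hI.out hx hq
    obtain ⟨c, hc, he⟩ := exists_hasDerivAt_eq_slope h h' hlt
      (fun y hy => (hd y (hsub hy)).continuousAt.continuousWithinAt)
      (fun y hy => hd y (hsub (Set.Ioo_subset_Icc_self hy)))
    have h0 : h' c ≤ 0 := by
      have := hs c (hsub (Set.Ioo_subset_Icc_self hc))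
      by_contra! hpos
      nlinarith [mul_pos hpos (sub_pos.2 hc.2)]
    rw [eq_div_iff (sub_pos.2 hlt).ne'] at he
    nlinarith [mul_nonneg (neg_nonneg.2 h0) (sub_pos.2 hlt).le]

/-- Comparison of `f` with the exponential function tangent to it at `q`. -/
lemma mul_one_sub_exp_le {I : Set ℝ} (hI : I.OrdConnected) {f f' f'' : ℝ → ℝ}
    (hd1 : ∀ x ∈ I, HasDerivAt f (f' x) x) (hd2 : ∀ x ∈ I, HasDerivAt f' (f'' x) x)
    {s : ℝ} (hs : ∀ x ∈ I, 0 ≤ s * (f'' x + s * f' x))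
    {q x : ℝ} (hq : q ∈ I) (hx : x ∈ I) :
    f' q * (1 - Real.exp (-s * (x - q))) ≤ s * (f x - f q) := by
  have hexp : ∀ t y : ℝ,
      HasDerivAt (fun y => Real.exp (t * (y - q))) (Real.exp (t * (y - q)) * t) y := by
    intro t y
    simpa using (((hasDerivAt_id y).sub_const q).const_mul t).exp
  have hk : MonotoneOn (fun y => s * (f' y * Real.exp (s * (y - q)))) I := by
    have hdk : ∀ y ∈ I, HasDerivAt (fun y => s * (f' y * Real.exp (s * (y - q))))
        (s * (f'' y * Real.exp (s * (y - q)) + f' y * (Real.exp (s * (y - q)) * s))) y :=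
      fun y hy => ((hd2 y hy).mul (hexp s y)).const_mul s
    refine monotoneOn_of_deriv_nonneg hI.convex
      (fun y hy => (hdk y hy).continuousAt.continuousWithinAt)
      (fun y hy => (hdk y (interior_subset hy)).differentiableAt.differentiableWithinAt) ?_
    intro y hy
    have hy := interior_subset hy
    rw [(hdk y hy).deriv]
    have := mul_nonneg (hs y hy) (Real.exp_pos (s * (y - q))).le
    linarith
  have hmin := le_of_hasDerivAt_mul_sub_nonneg hI
    (h := fun y => s * f y + f' q * Real.exp (-s * (y - q)))
    (h' := fun y => s * f' y + f' q * (Real.exp (-s * (y - q)) * -s))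
    (fun y hy => ((hd1 y hy).const_mul s).add ((hexp (-s) y).const_mul (f' q))) hq hx ?_
  · simp only [sub_self, mul_zero, Real.exp_zero, mul_one] at hmin
    linarith
  · intro c hc
    have hprod : Real.exp (s * (c - q)) * Real.exp (-s * (c - q)) = 1 := by
      rw [← Real.exp_add]; simp
    have hEq : (s * f' c + f' q * (Real.exp (-s * (c - q)) * -s)) * (c - q) =
        Real.exp (-s * (c - q)) *
          ((s * (f' c * Real.exp (s * (c - q))) - s * f' q) * (c - q)) := by
      linear_combination -(s * f' c * (c - q)) * hprod
    rw [hEq]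
    refine mul_nonneg (Real.exp_pos _).le ?_
    rcases le_total q c with h | h
    · have := hk hq hc h
      simp only [sub_self, mul_zero, Real.exp_zero, mul_one] at this
      exact mul_nonneg (sub_nonneg.2 this) (sub_nonneg.2 h)
    · have := hk hc hq h
      simp only [sub_self, mul_zero, Real.exp_zero, mul_one] at this
      exact mul_nonneg_of_nonpos_of_nonpos (sub_nonpos.2 this) (sub_nonpos.2 h)

/-- Under `|f''| ≤ f'`, the quasi-arithmetic mean is at most the exponential mean and, taking
`s = 1`, at least its reflection. -/
lemma card_le_sum_exp {I : Set ℝ} (hI : I.OrdConnected) {f f' f'' : ℝ → ℝ}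
    (hd1 : ∀ x ∈ I, HasDerivAt f (f' x) x) (hd2 : ∀ x ∈ I, HasDerivAt f' (f'' x) x)
    {s : ℝ} (hs : ∀ x ∈ I, 0 ≤ s * (f'' x + s * f' x))
    {n : ℕ} {a : Fin n → ℝ} (ha : ∀ i, a i ∈ I) {q : ℝ} (hq : q ∈ I) (hpos : 0 < f' q)
    (hsum : ∑ i, f (a i) = n * f q) :
    (n : ℝ) ≤ ∑ i, Real.exp (-s * (a i - q)) := by
  have h := Finset.sum_le_sum fun i (_ : i ∈ Finset.univ) =>
    mul_one_sub_exp_le hI hd1 hd2 hs hq (ha i)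
  simp only [← Finset.mul_sum, Finset.sum_sub_distrib, hsum, Finset.sum_const,
    Finset.card_univ, Fintype.card_fin, nsmul_eq_mul, mul_one, sub_self, mul_zero] at h
  by_contra! hlt
  nlinarith [mul_pos hpos (sub_pos.2 hlt)]

lemma exists_nonneg_of_card_le_sum_exp {n : ℕ} (hn : 0 < n) {t : Fin n → ℝ}
    (h : (n : ℝ) ≤ ∑ i, Real.exp (t i)) : ∃ i, 0 ≤ t i := by
  by_contra! hlt
  have : Nonempty (Fin n) := ⟨⟨0, hn⟩⟩
  have := Finset.sum_lt_sum_of_nonempty Finset.univ_nonempty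
    fun i (_ : i ∈ Finset.univ) => Real.exp_lt_one_iff.2 (hlt i)
  simp only [Finset.sum_const, Finset.card_univ, Fintype.card_fin, nsmul_eq_mul, mul_one] at this
  linarith

lemma neg_sq_mul_le_sum_of_card_le_sum_exp {n : ℕ} {t : Fin n → ℝ} {d : ℝ} (hd : d ≤ 1)
    (ht : ∀ i, |t i| ≤ d) (h : (n : ℝ) ≤ ∑ i, Real.exp (t i)) :
    -(n * d ^ 2) ≤ ∑ i, t i := by
  have hle : ∑ i, Real.exp (t i) ≤ ∑ i, (1 + t i + d ^ 2) := by
    refine Finset.sum_le_sum fun i _ => ?_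
    have h1 := (abs_le.1 (Real.abs_exp_sub_one_sub_id_le ((ht i).trans hd))).2
    have h2 : t i ^ 2 ≤ d ^ 2 := sq_le_sq' (abs_le.1 (ht i)).1 (abs_le.1 (ht i)).2
    linarith
  simp only [Finset.sum_add_distrib, Finset.sum_const, Finset.card_univ, Fintype.card_fin,
    nsmul_eq_mul, mul_one] at hle
  linarith

lemma abs_sub_le_deltaV {n : ℕ} (a : Fin n → ℝ) {q : ℝ} {j k : Fin n} (hj : a j ≤ q)
    (hk : q ≤ a k) (i : Fin n) : |a i - q| ≤ deltaV a := by
  have hfin := Set.finite_range a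
  have hle : ∀ l, a l ≤ sSup (Set.range a) := fun l =>
    le_csSup hfin.bddAbove (Set.mem_range_self l)
  have hge : ∀ l, sInf (Set.range a) ≤ a l := fun l =>
    csInf_le hfin.bddBelow (Set.mem_range_self l)
  rw [deltaV, abs_le]
  constructor <;> linarith [hle i, hle k, hge i, hge j]

lemma abs_sub_amean_le_deltaV_sq {I : Set ℝ} (hI : I.OrdConnected) {f f' f'' : ℝ → ℝ}
    (hd1 : ∀ x ∈ I, HasDerivAt f (f' x) x) (hd2 : ∀ x ∈ I, HasDerivAt f' (f'' x) x)
    (hpos : ∀ x ∈ I, 0 < f' x) (hbd : ∀ x ∈ I, |f'' x| ≤ f' x)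
    {n : ℕ} (hn : 0 < n) {a : Fin n → ℝ} (ha : ∀ i, a i ∈ I) {q : ℝ} (hq : q ∈ I)
    (hsum : ∑ i, f (a i) = n * f q) : |q - amean a| ≤ deltaV a ^ 2 := by
  have hlow : (n : ℝ) ≤ ∑ i, Real.exp (-1 * (a i - q)) :=
    card_le_sum_exp hI hd1 hd2 (fun x hx => by linarith [(abs_le.1 (hbd x hx)).1])
      ha hq (hpos q hq) hsum
  have hupp : (n : ℝ) ≤ ∑ i, Real.exp (-(-1) * (a i - q)) :=
    card_le_sum_exp hI hd1 hd2 (fun x hx => by linarith [(abs_le.1 (hbd x hx)).2])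
      ha hq (hpos q hq) hsum
  obtain ⟨j, hj⟩ := exists_nonneg_of_card_le_sum_exp hn hlow
  obtain ⟨k, hk⟩ := exists_nonneg_of_card_le_sum_exp hn hupp
  have hdist := abs_sub_le_deltaV a (q := q) (j := j) (k := k) (by linarith) (by linarith)
  have hn' : (0 : ℝ) < n := by exact_mod_cast hn
  have hmean : ∑ i, (a i - q) = n * (amean a - q) := by
    rw [amean, mul_sub, mul_div_cancel₀ _ hn'.ne']
    simp
  rcases le_total (deltaV a) 1 with hd | hd
  · have h1 := neg_sq_mul_le_sum_of_card_le_sum_exp hd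
      (fun i => by rw [abs_mul]; simpa using hdist i) hlow
    have h2 := neg_sq_mul_le_sum_of_card_le_sum_exp hd
      (fun i => by rw [abs_mul]; simpa using hdist i) hupp
    rw [← Finset.mul_sum, hmean] at h1 h2
    rw [abs_le]
    constructor <;> refine le_of_mul_le_mul_left ?_ hn' <;> linarith
  · have h1 : |∑ i, (a i - q)| ≤ n * deltaV a := by
      refine (Finset.abs_sum_le_sum_abs _ _).trans ?_
      simpa using Finset.sum_le_sum fun i (_ : i ∈ Finset.univ) => hdist i
    rw [hmean, abs_mul, abs_of_pos hn', abs_sub_comm] at h1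
    have h2 := le_of_mul_le_mul_left h1 hn'
    nlinarith

theorem quasiArithMean_close_to_arithMean
    (I : Set ℝ) (hI : I.OrdConnected)
    (f f' f'' : ℝ → ℝ)
    (hd1 : ∀ x ∈ I, HasDerivAt f (f' x) x)
    (hd2 : ∀ x ∈ I, HasDerivAt f' (f'' x) x)
    (hc : ContinuousOn f'' I)
    (hne : ∀ x ∈ I, f' x ≠ 0)
    (hAP : ∀ x ∈ I, |f'' x / f' x| ≤ 1)
    (n : ℕ) (hn : 0 < n) (a : Fin n → ℝ) (ha : ∀ i, a i ∈ I)
    (Q : ℝ) (hQI : Q ∈ I) (hQ : f Q = (∑ i, f (a i)) / n) :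
    |Q - amean a| ≤ (3 + 7 * Real.exp 1) / 3 / 2 * deltaV a ^ 2 := by
  have hn' : (0 : ℝ) < n := by exact_mod_cast hn
  have hsum : ∑ i, f (a i) = n * f Q := by rw [hQ, mul_div_cancel₀ _ hn'.ne']
  have hbd : ∀ x ∈ I, |f'' x| ≤ |f' x| := fun x hx => by
    simpa [abs_div, div_le_one (abs_pos.2 (hne x hx))] using hAP x hx
  have hcont : ContinuousOn f' I := fun x hx => (hd2 x hx).continuousAt.continuousWithinAt
  have hsign : (∀ x ∈ I, 0 < f' x) ∨ ∀ x ∈ I, f' x < 0 := by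
    by_contra! h
    obtain ⟨⟨x, hx, hx0⟩, y, hy, hy0⟩ := h
    obtain ⟨z, hz, hz0⟩ := hI.isPreconnected.intermediate_value hx hy hcont ⟨hx0, hy0⟩
    exact hne z hz hz0
  have key : |Q - amean a| ≤ deltaV a ^ 2 := by
    rcases hsign with hpos | hneg
    · exact abs_sub_amean_le_deltaV_sq hI hd1 hd2 hpos
        (fun x hx => (hbd x hx).trans_eq (abs_of_pos (hpos x hx))) hn ha hQI hsum
    · refine abs_sub_amean_le_deltaV_sq hI (f := fun x => -f x) (f' := fun x => -f' x)
        (f'' := fun x => -f'' x) (fun x hx => (hd1 x hx).neg) (fun x hx => (hd2 x hx).neg)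
        (fun x hx => neg_pos.2 (hneg x hx))
        (fun x hx => ?_) hn ha hQI (by simp [hsum])
      rw [abs_neg]
      exact (hbd x hx).trans_eq (abs_of_neg (hneg x hx))
  have hexp : (1 : ℝ) ≤ Real.exp 1 := Real.one_le_exp zero_le_one
  exact key.trans (le_mul_of_one_le_left (sq_nonneg _) (by linarith))
end

section
/- Let I be a real interval, n ∈ ℕ, and let f₁,…,fₙ : I → ℝ be C² functions with nowhere vanishing first derivative such that each fₖ″ is Lipschitz on I with Lipschitz constant Lₖ and ‖fₖ″/fₖ′‖_∞ ≤ 1. Let a ∈ Iⁿ with δ(a) < 1 and set C := (1/n)Σₖ (Lₖ/(2|fₖ′(ā)|) + α²e/4) with α := (3+7e)/3. Then |(1/n)Σₖ QA_{fₖ}(a) − ā − (1/2)·Var(a)·(1/n)Σₖ fₖ″(ā)/fₖ′(ā)| ≤ C·δ(a)³. -/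
theorem exists_sub_eq_deriv_mul_sub {J : Set ℝ} (hJ : J.OrdConnected) {g g' : ℝ → ℝ}
    (hg : ∀ x ∈ J, HasDerivAt g (g' x) x) {x y : ℝ} (hx : x ∈ J) (hy : y ∈ J) :
    ∃ c ∈ J, g y - g x = g' c * (y - x) := by
  rcases lt_trichotomy x y with h | h | h
  · obtain ⟨c, hc, he⟩ := exists_hasDerivAt_eq_slope g g' h
      (fun t ht => (hg t (hJ.out hx hy ht)).continuousAt.continuousWithinAt)
      (fun t ht => hg t (hJ.out hx hy ⟨ht.1.le, ht.2.le⟩))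
    refine ⟨c, hJ.out hx hy ⟨hc.1.le, hc.2.le⟩, ?_⟩
    rw [he, div_mul_cancel₀ _ (sub_pos.2 h).ne']
  · exact ⟨x, hx, by simp [h]⟩
  · obtain ⟨c, hc, he⟩ := exists_hasDerivAt_eq_slope g g' h
      (fun t ht => (hg t (hJ.out hy hx ht)).continuousAt.continuousWithinAt)
      (fun t ht => hg t (hJ.out hy hx ⟨ht.1.le, ht.2.le⟩))
    refine ⟨c, hJ.out hy hx ⟨hc.1.le, hc.2.le⟩, ?_⟩
    rw [he, ← neg_sub x y, mul_neg, div_mul_cancel₀ _ (sub_pos.2 h).ne', neg_sub]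

/-- First-order Taylor estimate with a bound on the second derivative. -/
theorem abs_taylor_remainder_le {J : Set ℝ} (hJ : J.OrdConnected) {g g' g'' : ℝ → ℝ} {M : ℝ}
    (hg : ∀ x ∈ J, HasDerivAt g (g' x) x) (hg' : ∀ x ∈ J, HasDerivAt g' (g'' x) x)
    (hM : ∀ x ∈ J, |g'' x| ≤ M) {m y : ℝ} (hm : m ∈ J) (hy : y ∈ J) :
    |g y - g m - g' m * (y - m)| ≤ M / 2 * (y - m) ^ 2 := by
  have hmem : ∀ s ∈ Set.Icc (0 : ℝ) 1, m + s * (y - m) ∈ J := fun s hs => by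
    have := hJ.convex.add_smul_sub_mem hm hy hs
    simpa [smul_eq_mul] using this
  have hlip : ∀ t ∈ J, |g' t - g' m| ≤ M * |t - m| := fun t ht => by
    obtain ⟨c, hc, he⟩ := exists_sub_eq_deriv_mul_sub hJ hg' hm ht
    rw [he, abs_mul]
    exact mul_le_mul_of_nonneg_right (hM c hc) (abs_nonneg _)
  have hd : ∀ s ∈ Set.Icc (0 : ℝ) 1,
      HasDerivAt (fun s => g (m + s * (y - m)) - g m - g' m * (s * (y - m)))
        ((g' (m + s * (y - m)) - g' m) * (y - m)) s := fun s hs => by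
    have h1 : HasDerivAt (fun s : ℝ => s * (y - m)) (1 * (y - m)) s :=
      (hasDerivAt_id s).mul_const _
    have h2 := ((hg _ (hmem s hs)).comp s (h1.const_add m)).sub_const (g m)
    exact (h2.sub (h1.const_mul (g' m))).congr_deriv (by ring)
  have hB : ∀ s : ℝ, HasDerivAt (fun s => M / 2 * (y - m) ^ 2 * s ^ 2)
      (M * (y - m) ^ 2 * s) s := fun s =>
    ((hasDerivAt_pow 2 s).const_mul (M / 2 * (y - m) ^ 2)).congr_deriv (by push_cast; ring)
  have key := image_norm_le_of_norm_deriv_right_le_deriv_boundary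
    (fun s hs => (hd s hs).continuousAt.continuousWithinAt)
    (fun s hs => (hd s (Set.Ico_subset_Icc_self hs)).hasDerivWithinAt)
    (by simp) hB
    (fun s hs => by
      rw [Real.norm_eq_abs, abs_mul]
      have h := hlip _ (hmem s (Set.Ico_subset_Icc_self hs))
      rw [add_sub_cancel_left, abs_mul, abs_of_nonneg hs.1] at h
      calc _ ≤ M * (s * |y - m|) * |y - m| := mul_le_mul_of_nonneg_right h (abs_nonneg _)
        _ = M * (y - m) ^ 2 * s := by rw [← sq_abs (y - m)]; ring)
    (Set.right_mem_Icc.2 zero_le_one)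
  simpa using key

/-- A Grönwall estimate: if `|g'| ≤ |g|` then `g` grows at most exponentially. -/
theorem abs_le_exp_mul_abs_of_abs_deriv_le {J : Set ℝ} (hJ : J.OrdConnected) {g g' : ℝ → ℝ}
    (hg : ∀ x ∈ J, HasDerivAt g (g' x) x) (hle : ∀ x ∈ J, |g' x| ≤ |g x|)
    {x y : ℝ} (hx : x ∈ J) (hy : y ∈ J) :
    |g y| ≤ Real.exp |y - x| * |g x| := by
  have hprod : ∀ t ∈ J, |g t * g' t| ≤ g t ^ 2 := fun t ht => by
    rw [abs_mul, ← sq_abs, sq]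
    exact mul_le_mul_of_nonneg_left (hle t ht) (abs_nonneg _)
  have hsq : ∀ σ : ℝ, ∀ t ∈ J, HasDerivAt (fun t => g t ^ 2 * Real.exp (2 * σ * t))
      (2 * (g t * g' t + σ * g t ^ 2) * Real.exp (2 * σ * t)) t := fun σ t ht => by
    have h1 : HasDerivAt (fun t => Real.exp (2 * σ * t)) (Real.exp (2 * σ * t) * (2 * σ)) t := by
      simpa using ((hasDerivAt_id t).const_mul (2 * σ)).exp
    exact (((hg t ht).pow 2).mul h1).congr_deriv
      (by rw [Pi.pow_apply]; push_cast; ring)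
  have hbound : g y ^ 2 ≤ Real.exp (2 * |y - x|) * g x ^ 2 := by
    rcases le_total x y with h | h
    · obtain ⟨c, hc, he⟩ := exists_sub_eq_deriv_mul_sub hJ (hsq (-1)) hx hy
      have h1 := (abs_le.1 (hprod c hc)).2
      have h2 : g y ^ 2 * Real.exp (2 * -1 * y) ≤ g x ^ 2 * Real.exp (2 * -1 * x) := by
        have : 0 ≤ (g c ^ 2 - g c * g' c) * Real.exp (2 * -1 * c) * (y - x) :=
          mul_nonneg (mul_nonneg (by linarith) (Real.exp_pos _).le) (by linarith)
        linarith
      have h3 := mul_le_mul_of_nonneg_right h2 (Real.exp_pos (2 * y)).le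
      rw [mul_assoc (g y ^ 2), mul_assoc (g x ^ 2), ← Real.exp_add, ← Real.exp_add] at h3
      rw [abs_of_nonneg (sub_nonneg.2 h)]
      ring_nf at h3 ⊢
      simpa using h3
    · obtain ⟨c, hc, he⟩ := exists_sub_eq_deriv_mul_sub hJ (hsq 1) hx hy
      have h1 := (abs_le.1 (hprod c hc)).1
      have h2 : g y ^ 2 * Real.exp (2 * 1 * y) ≤ g x ^ 2 * Real.exp (2 * 1 * x) := by
        have : 0 ≤ (g c ^ 2 + g c * g' c) * Real.exp (2 * 1 * c) * (x - y) :=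
          mul_nonneg (mul_nonneg (by linarith) (Real.exp_pos _).le) (by linarith)
        linarith
      have h3 := mul_le_mul_of_nonneg_right h2 (Real.exp_pos (-2 * y)).le
      rw [mul_assoc (g y ^ 2), mul_assoc (g x ^ 2), ← Real.exp_add, ← Real.exp_add] at h3
      rw [abs_of_nonpos (sub_nonpos.2 h)]
      ring_nf at h3 ⊢
      simpa using h3
  refine abs_le_of_sq_le_sq' ?_ (by positivity) |> abs_le.2
  rw [mul_pow, sq_abs, ← Real.exp_nat_mul]
  exact_mod_cast hbound

theorem amean_sub_amean_eq_zero {n : ℕ} (hn : 0 < n) (a : Fin n → ℝ) :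
    amean (fun i => a i - amean a) = 0 := by
  have : (n : ℝ) ≠ 0 := by positivity
  simp only [amean, Finset.sum_sub_distrib, Finset.sum_const, Finset.card_univ, Fintype.card_fin,
    nsmul_eq_mul]
  field_simp
  ring

theorem abs_amean_le_amean {n : ℕ} {u v : Fin n → ℝ} (h : ∀ i, |u i| ≤ v i) :
    |amean u| ≤ amean v := by
  rw [amean, amean, abs_div, Nat.abs_cast]
  exact div_le_div_of_nonneg_right
    ((Finset.abs_sum_le_sum_abs _ _).trans (Finset.sum_le_sum fun i _ => h i)) n.cast_nonneg

theorem amean_const {n : ℕ} (hn : 0 < n) (c : ℝ) : amean (fun _ : Fin n => c) = c := by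
  have : (n : ℝ) ≠ 0 := by positivity
  simp [amean, this]

theorem amean_mem_of_convex {n : ℕ} (hn : 0 < n) {s : Set ℝ} (hs : Convex ℝ s) {u : Fin n → ℝ}
    (hu : ∀ i, u i ∈ s) : amean u ∈ s := by
  have hne : (n : ℝ) ≠ 0 := by positivity
  have := hs.sum_mem (t := Finset.univ) (w := fun _ : Fin n => (n : ℝ)⁻¹) (z := u)
    (fun _ _ => by positivity) (by simp [hne]) (fun i _ => hu i)
  rwa [← Finset.smul_sum, smul_eq_mul, inv_mul_eq_div] at this

/-- Single-function expansion of a quasi-arithmetic mean on an interval of length `d < 1`. -/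
theorem abs_quasiArithMean_sub_expansion_le {lo hi L : ℝ} (hlt : hi - lo < 1)
    {n : ℕ} (hn : 0 < n) {f f' f'' : ℝ → ℝ}
    (hd1 : ∀ x ∈ Set.Icc lo hi, HasDerivAt f (f' x) x)
    (hd2 : ∀ x ∈ Set.Icc lo hi, HasDerivAt f' (f'' x) x)
    (hne : ∀ x ∈ Set.Icc lo hi, f' x ≠ 0) (hL : 0 ≤ L)
    (hLip : ∀ x ∈ Set.Icc lo hi, ∀ y ∈ Set.Icc lo hi, |f'' x - f'' y| ≤ L * |x - y|)
    (hle : ∀ x ∈ Set.Icc lo hi, |f'' x| ≤ |f' x|)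
    {a : Fin n → ℝ} (ha : ∀ i, a i ∈ Set.Icc lo hi) {q : ℝ} (hq : q ∈ Set.Icc lo hi)
    (hfq : f q = amean (fun i => f (a i))) :
    |q - amean a - 1 / 2 * varV a * (f'' (amean a) / f' (amean a))|
      ≤ (L / (2 * |f' (amean a)|) + Real.exp 1 ^ 5 / 8) * (hi - lo) ^ 3 := by
  have hJ : (Set.Icc lo hi).OrdConnected := Set.ordConnected_Icc
  have hm : amean a ∈ Set.Icc lo hi := amean_mem_of_convex hn (convex_Icc lo hi) ha
  set m := amean a with hmdef
  set d := hi - lo with hd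
  have hd0 : 0 ≤ d := by have := hm.1.trans hm.2; linarith
  have hn0 : (n : ℝ) ≠ 0 := by positivity
  have hdist : ∀ x ∈ Set.Icc lo hi, ∀ y ∈ Set.Icc lo hi, |x - y| ≤ d := fun x hx y hy =>
    abs_le.2 ⟨by linarith [hx.1, hy.2], by linarith [hx.2, hy.1]⟩
  have hF : 0 < |f' m| := abs_pos.2 (hne m hm)
  have hexp : ∀ x ∈ Set.Icc lo hi, ∀ y ∈ Set.Icc lo hi,
      |f' y| ≤ Real.exp 1 * |f' x| := fun x hx y hy =>
    (abs_le_exp_mul_abs_of_abs_deriv_le hJ hd2 hle hx hy).trans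
      (mul_le_mul_of_nonneg_right
        (Real.exp_le_exp.2 ((hdist y hy x hx).trans hlt.le)) (abs_nonneg _))
  have he0 := Real.exp_pos 1
  set e := Real.exp 1
  have hsqd : ∀ x ∈ Set.Icc lo hi, (x - m) ^ 2 ≤ d ^ 2 := fun x hx => by
    rw [← sq_abs]
    exact pow_le_pow_left₀ (abs_nonneg _) (hdist x hx m hm) 2
  have htaylor : ∀ x ∈ Set.Icc lo hi,
      |f x - f m - f' m * (x - m)| ≤ e * |f' m| / 2 * (x - m) ^ 2 := fun x hx =>
    abs_taylor_remainder_le hJ hd1 hd2 (fun t ht => (hle t ht).trans (hexp m hm t ht)) hm hx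
  have htaylor₂ : ∀ x ∈ Set.Icc lo hi,
      |f x - f m - f' m * (x - m) - 1 / 2 * f'' m * (x - m) ^ 2| ≤ L / 2 * d ^ 3 := by
    intro x hx
    have h := abs_taylor_remainder_le hJ (g := fun t => f t - 1 / 2 * f'' m * (t - m) ^ 2)
      (g' := fun t => f' t - f'' m * (t - m)) (g'' := fun t => f'' t - f'' m) (M := L * d)
      (fun t ht => ((hd1 t ht).sub
        ((((hasDerivAt_id t).sub_const m).pow 2).const_mul (1 / 2 * f'' m))).congr_deriv
          (by simp; ring))
      (fun t ht => ((hd2 t ht).sub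
        (((hasDerivAt_id t).sub_const m).const_mul (f'' m))).congr_deriv (by simp))
      (fun t ht => (hLip t ht m hm).trans
        (mul_le_mul_of_nonneg_left (hdist t ht m hm) hL)) hm hx
    have h' : L * d / 2 * (x - m) ^ 2 ≤ L * d / 2 * d ^ 2 :=
      mul_le_mul_of_nonneg_left (hsqd x hx) (by positivity)
    calc _ = |_| := by congr 1; ring
      _ ≤ _ := h
      _ ≤ _ := h'
      _ = L / 2 * d ^ 3 := by ring
  have hzero : amean (fun i => a i - m) = 0 := amean_sub_amean_eq_zero hn a
  have hmean₁ : amean (fun i => f (a i) - f m - f' m * (a i - m)) = f q - f m := by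
    rw [hfq]
    have h0 : f' m * amean (fun i => a i - m) = 0 := by rw [hzero, mul_zero]
    simp only [amean] at h0 ⊢
    rw [Finset.sum_sub_distrib, Finset.sum_sub_distrib, ← Finset.mul_sum, sub_div, sub_div,
      mul_div_assoc, h0]
    simp [hn0]
  have hmean₂ : amean (fun i => f (a i) - f m - f' m * (a i - m) - 1 / 2 * f'' m * (a i - m) ^ 2)
      = f q - f m - 1 / 2 * f'' m * varV a := by
    rw [← hmean₁]
    simp only [amean, varV]
    rw [Finset.sum_sub_distrib, ← Finset.mul_sum, sub_div, mul_div_assoc]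
    rfl
  have hR : |f q - f m - 1 / 2 * f'' m * varV a| ≤ L / 2 * d ^ 3 := by
    rw [← hmean₂, ← amean_const hn (L / 2 * d ^ 3)]
    exact abs_amean_le_amean fun i => htaylor₂ _ (ha i)
  have hR₁ : |f q - f m| ≤ e * |f' m| / 2 * d ^ 2 := by
    rw [← hmean₁, ← amean_const hn (e * |f' m| / 2 * d ^ 2)]
    exact abs_amean_le_amean fun i => (htaylor _ (ha i)).trans
      (mul_le_mul_of_nonneg_left (hsqd _ (ha i)) (by positivity))
  have hx : |q - m| ≤ e ^ 2 / 2 * d ^ 2 := by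
    obtain ⟨c, hc, hce⟩ := exists_sub_eq_deriv_mul_sub hJ hd1 hm hq
    rw [hce, abs_mul] at hR₁
    have h1 := hexp c hc m hm
    have hcpos : 0 < |f' c| := abs_pos.2 (hne c hc)
    refine le_of_mul_le_mul_left (hR₁.trans ?_) hcpos
    have := mul_le_mul_of_nonneg_left h1 (by positivity : 0 ≤ e / 2 * d ^ 2)
    linarith
  have hx2 : (q - m) ^ 2 ≤ e ^ 4 / 4 * d ^ 3 := by
    have h1 := pow_le_pow_left₀ (abs_nonneg _) hx 2
    rw [sq_abs] at h1
    have h2 : d ^ 4 ≤ d ^ 3 := pow_le_pow_of_le_one hd0 hlt.le (by norm_num)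
    have h3 := mul_le_mul_of_nonneg_left h2 (by positivity : 0 ≤ e ^ 4 / 4)
    linarith
  have hE := (htaylor q hq).trans
    (mul_le_mul_of_nonneg_left hx2 (by positivity : 0 ≤ e * |f' m| / 2))
  have hid : q - m - 1 / 2 * varV a * (f'' m / f' m)
      = ((f q - f m - 1 / 2 * f'' m * varV a) - (f q - f m - f' m * (q - m))) / f' m := by
    have := hne m hm
    field_simp
    ring
  rw [hid, abs_div, div_le_iff₀ hF]
  refine (abs_sub _ _).trans ((add_le_add hR hE).trans (le_of_eq ?_))
  field_simp
  ring

theorem exp_one_pow_five_div_eight_le :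
    Real.exp 1 ^ 5 / 8 ≤ ((3 + 7 * Real.exp 1) / 3) ^ 2 * Real.exp 1 / 4 := by
  have h0 := Real.exp_pos 1
  have h3 : Real.exp 1 < 3 := Real.exp_one_lt_three
  set e := Real.exp 1
  have h1 : e ^ 2 ≤ 9 := by nlinarith
  have h2 : e ^ 4 ≤ 9 * e ^ 2 := by nlinarith [sq_nonneg e]
  have h4 : e ^ 4 ≤ 2 * ((3 + 7 * e) / 3) ^ 2 := by nlinarith
  nlinarith

theorem mean_of_quasiArithMeans_expansion
    (I : Set ℝ) (hI : I.OrdConnected) (n : ℕ) (hn : 0 < n)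
    (f f' f'' : Fin n → ℝ → ℝ) (L : Fin n → ℝ) (hL : ∀ k, 0 ≤ L k)
    (hd1 : ∀ k, ∀ x ∈ I, HasDerivAt (f k) (f' k x) x)
    (hd2 : ∀ k, ∀ x ∈ I, HasDerivAt (f' k) (f'' k x) x)
    (hc : ∀ k, ContinuousOn (f'' k) I)
    (hne : ∀ k, ∀ x ∈ I, f' k x ≠ 0)
    (hLip : ∀ k, ∀ x ∈ I, ∀ y ∈ I, |f'' k x - f'' k y| ≤ L k * |x - y|)
    (hAP : ∀ k, ∀ x ∈ I, |f'' k x / f' k x| ≤ 1)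
    (a : Fin n → ℝ) (ha : ∀ i, a i ∈ I) (hδ : deltaV a < 1)
    -- Q k is the quasi-arithmetic mean QA_{f_k}(a):
    (Q : Fin n → ℝ) (hQI : ∀ k, Q k ∈ I)
    (hQ : ∀ k, f k (Q k) = (∑ i, f k (a i)) / n) :
    |amean Q - amean a
        - 1 / 2 * varV a * amean (fun k => f'' k (amean a) / f' k (amean a))|
      ≤ amean (fun k => L k / (2 * |f' k (amean a)|)
          + ((3 + 7 * Real.exp 1) / 3) ^ 2 * Real.exp 1 / 4) * deltaV a ^ 3 := by
  have : Nonempty (Fin n) := ⟨⟨0, hn⟩⟩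
  have hfin : (Set.range a).Finite := Set.finite_range a
  have hran : (Set.range a).Nonempty := Set.range_nonempty a
  obtain ⟨i₀, hi₀⟩ := hran.csInf_mem hfin
  obtain ⟨i₁, hi₁⟩ := hran.csSup_mem hfin
  set lo := sInf (Set.range a)
  set hi := sSup (Set.range a)
  have hsub : Set.Icc lo hi ⊆ I := hI.out (hi₀ ▸ ha i₀) (hi₁ ▸ ha i₁)
  have ha' : ∀ i, a i ∈ Set.Icc lo hi := fun i =>
    ⟨csInf_le hfin.bddBelow ⟨i, rfl⟩, le_csSup hfin.bddAbove ⟨i, rfl⟩⟩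
  have hδ0 : 0 ≤ deltaV a := sub_nonneg.2 ((ha' i₀).1.trans (ha' i₀).2)
  have hQ' : ∀ k, Q k ∈ Set.Icc lo hi := fun k => by
    have hcont : ContinuousOn (f k) (Set.Icc lo hi) := fun t ht =>
      (hd1 k t (hsub ht)).continuousAt.continuousWithinAt
    obtain ⟨c, hc, hce⟩ := amean_mem_of_convex hn
      (isPreconnected_Icc.image _ hcont).ordConnected.convex
      (fun i => Set.mem_image_of_mem (f k) (ha' i))
    obtain ⟨ξ, hξ, hξe⟩ := exists_sub_eq_deriv_mul_sub hI (hd1 k) (hsub hc) (hQI k)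
    rw [hQ k, hce, amean, sub_self, eq_comm, mul_eq_zero, sub_eq_zero] at hξe
    rw [hξe.resolve_left (hne k ξ hξ)]
    exact hc
  have hk : ∀ k, |Q k - amean a - 1 / 2 * varV a * (f'' k (amean a) / f' k (amean a))|
      ≤ (L k / (2 * |f' k (amean a)|)
          + ((3 + 7 * Real.exp 1) / 3) ^ 2 * Real.exp 1 / 4) * deltaV a ^ 3 := fun k =>
    (abs_quasiArithMean_sub_expansion_le hδ hn (fun x hx => hd1 k x (hsub hx))
      (fun x hx => hd2 k x (hsub hx)) (fun x hx => hne k x (hsub hx)) (hL k)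
      (fun x hx y hy => hLip k x (hsub hx) y (hsub hy))
      (fun x hx => by
        have h := hAP k x (hsub hx)
        rwa [abs_div, div_le_one (abs_pos.2 (hne k x (hsub hx)))] at h)
      ha' (hQ' k) (hQ k)).trans
      (mul_le_mul_of_nonneg_right
        (by linarith [exp_one_pow_five_div_eight_le]) (pow_nonneg hδ0 3))
  have hsum := abs_amean_le_amean hk
  have hn0 : (n : ℝ) ≠ 0 := by positivity
  have hlhs : amean (fun k => Q k - amean a
        - 1 / 2 * varV a * (f'' k (amean a) / f' k (amean a)))
      = amean Q - amean a
        - 1 / 2 * varV a * amean (fun k => f'' k (amean a) / f' k (amean a)) := by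
    conv_lhs => rw [amean]
    rw [Finset.sum_sub_distrib, Finset.sum_sub_distrib, ← Finset.mul_sum, sub_div, sub_div,
      mul_div_assoc]
    congr 2
    simp [hn0]
  rw [hlhs] at hsum
  refine hsum.trans (le_of_eq ?_)
  rw [amean, ← Finset.sum_mul, mul_div_right_comm]
  rfl
end

section
/- Let I be a real interval, n ∈ ℕ, and let f₁,…,fₙ : I → ℝ be C² functions with nowhere vanishing first derivative such that each fₖ″ is Lipschitz on I with Lipschitz constant Lₖ and ‖fₖ″/fₖ′‖_∞ ≤ 1. Let a ∈ Iⁿ be nonconstant with δ(a) < 1, set α := (3+7e)/3, C := (1/n)Σₖ (Lₖ/(2|fₖ′(ā)|) + α²e/4) and C₂ := ((1/n)Σₖ (Lₖ/(2|fₖ′(ā)|) + α²e/4)²)^{1/2}. Then |Var(M_f(a))/Var(a)² − (1/4)·Var(A_f(ā))| ≤ 16n²C·δ(a) + 4n²(3C² + C₂²)·δ(a)². -/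
open Real Set Finset

/-- Second-order Taylor estimate. -/
theorem abs_taylor_two_le {h h' h'' : ℝ → ℝ} {m x c : ℝ}
    (hd1 : ∀ t ∈ uIcc m x, HasDerivAt h (h' t) t)
    (hd2 : ∀ t ∈ uIcc m x, HasDerivAt h' (h'' t) t)
    (hc : ∀ t ∈ uIcc m x, |h'' t| ≤ c) :
    |h x - h m - h' m * (x - m)| ≤ c / 2 * (x - m) ^ 2 := by
  have hmem : ∀ s ∈ Icc (0 : ℝ) 1, m + s * (x - m) ∈ uIcc m x := fun s hs => by
    rw [← segment_eq_uIcc, segment_eq_image']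
    exact ⟨s, hs, by simp⟩
  have hfirst : ∀ t ∈ uIcc m x, |h' t - h' m| ≤ c * |t - m| := fun t ht => by
    simpa using (convex_uIcc m x).norm_image_sub_le_of_norm_hasDerivWithin_le
      (fun u hu => (hd2 u hu).hasDerivWithinAt) hc left_mem_uIcc ht
  have hline : ∀ s : ℝ, HasDerivAt (fun s => m + s * (x - m)) (x - m) s := fun s => by
    simpa using ((hasDerivAt_id s).mul_const (x - m)).const_add m
  let φ : ℝ → ℝ := fun s => h (m + s * (x - m)) - h m - h' m * (s * (x - m))
  have hφ : ∀ s ∈ Icc (0 : ℝ) 1,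
      HasDerivAt φ ((h' (m + s * (x - m)) - h' m) * (x - m)) s := fun s hs => by
    have := (((hd1 _ (hmem s hs)).comp s (hline s)).sub_const (h m)).sub
      (((hasDerivAt_id s).mul_const (x - m)).const_mul (h' m))
    refine this.congr_deriv ?_
    ring
  have hB : ∀ s : ℝ, HasDerivAt (fun s => c / 2 * (x - m) ^ 2 * s ^ 2) (c * (x - m) ^ 2 * s) s :=
    fun s => by
      refine ((hasDerivAt_pow 2 s).const_mul (c / 2 * (x - m) ^ 2)).congr_deriv ?_
      norm_num
      ring
  have key := image_norm_le_of_norm_deriv_right_le_deriv_boundary (a := 0) (b := 1) (f := φ)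
    (f' := fun s => (h' (m + s * (x - m)) - h' m) * (x - m))
    (fun s hs => (hφ s hs).continuousAt.continuousWithinAt)
    (fun s hs => (hφ s (Ico_subset_Icc_self hs)).hasDerivWithinAt)
    (B := fun s => c / 2 * (x - m) ^ 2 * s ^ 2) (B' := fun s => c * (x - m) ^ 2 * s)
    (by simp [φ]) hB
    (fun s hs => by
      have h1 := hfirst _ (hmem s (Ico_subset_Icc_self hs))
      rw [add_sub_cancel_left, abs_mul, abs_of_nonneg hs.1] at h1
      rw [norm_mul, Real.norm_eq_abs, Real.norm_eq_abs, ← sq_abs (x - m)]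
      calc _ ≤ c * (s * |x - m|) * |x - m| := by gcongr
        _ = _ := by ring)
    (right_mem_Icc.2 zero_le_one)
  simpa [φ] using key

/-- If `|g' / g| ≤ 1` then `|g|` changes at most by a factor `exp |x - y|`. -/
theorem abs_le_mul_exp_of_abs_logDeriv_le_one {g g' : ℝ → ℝ} {J : Set ℝ} (hJ : Convex ℝ J)
    (hd : ∀ t ∈ J, HasDerivAt g (g' t) t) (hne : ∀ t ∈ J, g t ≠ 0)
    (hg : ∀ t ∈ J, |g' t / g t| ≤ 1) {x y : ℝ} (hx : x ∈ J) (hy : y ∈ J) :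
    |g x| ≤ |g y| * exp |x - y| := by
  have h := hJ.norm_image_sub_le_of_norm_hasDerivWithin_le
    (fun t ht => ((hd t ht).log (hne t ht)).hasDerivWithinAt) hg hy hx
  rw [one_mul, Real.norm_eq_abs, Real.norm_eq_abs] at h
  rw [← Real.exp_log_eq_abs (hne x hx), ← Real.exp_log_eq_abs (hne y hy), ← Real.exp_add]
  exact Real.exp_le_exp.2 (by linarith [le_of_abs_le h])

theorem sum_sub_amean {n : ℕ} (hn : 0 < n) (a : Fin n → ℝ) : ∑ i, (a i - amean a) = 0 := by
  have : (n : ℝ) ≠ 0 := by positivity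
  simp [amean]
  field_simp
  simp

theorem varV_nonneg {n : ℕ} (a : Fin n → ℝ) : 0 ≤ varV a :=
  div_nonneg (sum_nonneg fun _ _ => sq_nonneg _) n.cast_nonneg

theorem varV_pos {n : ℕ} (hn : 0 < n) {a : Fin n → ℝ} (hnc : ∃ i j, a i ≠ a j) : 0 < varV a := by
  refine div_pos ?_ (by positivity)
  refine (sum_nonneg fun _ _ => sq_nonneg _).lt_of_ne' fun h => ?_
  rw [sum_eq_zero_iff_of_nonneg fun _ _ => sq_nonneg _] at h
  have hconst : ∀ i, a i = amean a := fun i => sub_eq_zero.1 (by simpa using h i (mem_univ i))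
  obtain ⟨i, j, hij⟩ := hnc
  exact hij ((hconst i).trans (hconst j).symm)

theorem div_card_mem_of_forall_mem {n : ℕ} (hn : 0 < n) {S : Set ℝ} (hS : Convex ℝ S)
    {b : Fin n → ℝ} (hb : ∀ i, b i ∈ S) : (∑ i, b i) / n ∈ S := by
  have hn' : (n : ℝ) ≠ 0 := by positivity
  have := hS.sum_mem (t := univ) (w := fun _ : Fin n => (n : ℝ)⁻¹) (fun _ _ => by positivity)
    (by simp [hn']) (fun i _ => hb i)
  rwa [← smul_sum, smul_eq_mul, inv_mul_eq_div] at this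

/-- A quasi-arithmetic mean of points of a segment lies in that segment. -/
theorem quasiArithMean_mem_Icc {n : ℕ} (hn : 0 < n) {I : Set ℝ} (hI : I.OrdConnected)
    {f f' : ℝ → ℝ} (hd : ∀ x ∈ I, HasDerivAt f (f' x) x) (hne : ∀ x ∈ I, f' x ≠ 0)
    {lo hi : ℝ} (hlo : lo ∈ I) (hhi : hi ∈ I) {a : Fin n → ℝ} (ha : ∀ i, a i ∈ Icc lo hi)
    {q : ℝ} (hqI : q ∈ I) (hq : f q = (∑ i, f (a i)) / n) : q ∈ Icc lo hi := by
  have hJ : Icc lo hi ⊆ I := hI.out hlo hhi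
  have hinj : ∀ x ∈ I, ∀ y ∈ I, x < y → f x ≠ f y := fun x hx y hy hxy h => by
    have hsub : Icc x y ⊆ I := hI.out hx hy
    obtain ⟨z, hz, hz0⟩ := exists_hasDerivAt_eq_zero hxy
      (fun t ht => (hd t (hsub ht)).continuousAt.continuousWithinAt) h
      (fun t ht => hd t (hsub (Ioo_subset_Icc_self ht)))
    exact hne z (hsub (Ioo_subset_Icc_self hz)) hz0
  have himg : Convex ℝ (f '' Icc lo hi) := Real.convex_iff_isPreconnected.2 <|
    isPreconnected_Icc.image f fun t ht => (hd t (hJ ht)).continuousAt.continuousWithinAt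
  obtain ⟨z, hz, hzq⟩ := div_card_mem_of_forall_mem hn himg fun i => mem_image_of_mem f (ha i)
  rw [← hq] at hzq
  rcases lt_trichotomy z q with h | h | h
  · exact absurd hzq (hinj z (hJ hz) q hqI h)
  · exact h ▸ hz
  · exact absurd hzq.symm (hinj q hqI z (hJ hz) h)

theorem abs_sum_div_le_mul_varV {n : ℕ} (hn : 0 < n) {a b : Fin n → ℝ} {K : ℝ}
    (hb : ∀ i, |b i| ≤ K * (a i - amean a) ^ 2) : |(∑ i, b i) / n| ≤ K * varV a := by
  rw [abs_div, abs_of_pos (by positivity : (0 : ℝ) < n), varV, ← mul_div_assoc, mul_sum]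
  gcongr
  exact (abs_sum_le_sum_abs _ _).trans (sum_le_sum fun i _ => hb i)

theorem varV_le_sq_of_mem_Icc {n : ℕ} (hn : 0 < n) {a : Fin n → ℝ} {lo hi : ℝ}
    (ha : ∀ i, a i ∈ Icc lo hi) : varV a ≤ (hi - lo) ^ 2 := by
  have hm : amean a ∈ Icc lo hi := div_card_mem_of_forall_mem hn (convex_Icc lo hi) ha
  have h : ∀ i, (a i - amean a) ^ 2 ≤ (hi - lo) ^ 2 := fun i => by
    have := ha i
    exact sq_le_sq' (by linarith [this.1, hm.2]) (by linarith [this.2, hm.1])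
  rw [varV, div_le_iff₀ (by positivity)]
  calc _ ≤ ∑ _i : Fin n, (hi - lo) ^ 2 := sum_le_sum fun i _ => h i
    _ = _ := by simp [mul_comm]

/-- Second-order expansion of a quasi-arithmetic mean around the arithmetic mean. -/
theorem abs_quasiArithMean_sub_le {n : ℕ} (hn : 0 < n) {f f' f'' : ℝ → ℝ} {L lo hi : ℝ}
    (hL : 0 ≤ L)
    (hd1 : ∀ x ∈ Icc lo hi, HasDerivAt f (f' x) x)
    (hd2 : ∀ x ∈ Icc lo hi, HasDerivAt f' (f'' x) x)
    (hne : ∀ x ∈ Icc lo hi, f' x ≠ 0)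
    (hLip : ∀ x ∈ Icc lo hi, ∀ y ∈ Icc lo hi, |f'' x - f'' y| ≤ L * |x - y|)
    (hAP : ∀ x ∈ Icc lo hi, |f'' x / f' x| ≤ 1)
    {a : Fin n → ℝ} (ha : ∀ i, a i ∈ Icc lo hi) (hδ : hi - lo ≤ 1)
    {q : ℝ} (hqJ : q ∈ Icc lo hi) (hq : f q = (∑ i, f (a i)) / n) :
    |q - amean a - 1 / 2 * (f'' (amean a) / f' (amean a)) * varV a| ≤
      (L / (2 * |f' (amean a)|) + exp 1 ^ 5 / 8) * (hi - lo) * varV a := by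
  have hn' : (n : ℝ) ≠ 0 := by positivity
  have hm : amean a ∈ Icc lo hi := div_card_mem_of_forall_mem hn (convex_Icc lo hi) ha
  have hcent := sum_sub_amean hn a
  have hV := varV_nonneg a
  have hVδ := varV_le_sq_of_mem_Icc hn ha
  have hVdef : varV a = (∑ i, (a i - amean a) ^ 2) / n := rfl
  have hsumb : ∀ {K : ℝ} {b : Fin n → ℝ}, (∀ i, |b i| ≤ K * (a i - amean a) ^ 2) →
      |(∑ i, b i) / n| ≤ K * varV a := abs_sum_div_le_mul_varV hn
  generalize amean a = m at *
  generalize varV a = V at *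
  set d := hi - lo with hd
  have hd0 : 0 ≤ d := by linarith [hm.1, hm.2]
  have hdist : ∀ x ∈ Icc lo hi, ∀ y ∈ Icc lo hi, |x - y| ≤ d := fun x hx y hy =>
    abs_sub_le_iff.2 ⟨by linarith [hx.2, hy.1], by linarith [hx.1, hy.2]⟩
  have hsub : ∀ x ∈ Icc lo hi, uIcc m x ⊆ Icc lo hi := fun x hx => uIcc_subset_Icc hm hx
  have hD : 0 < |f' m| := abs_pos.2 (hne m hm)
  have hexp : ∀ x ∈ Icc lo hi, ∀ y ∈ Icc lo hi, |f' x| ≤ |f' y| * exp 1 := fun x hx y hy =>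
    (abs_le_mul_exp_of_abs_logDeriv_le_one (convex_Icc lo hi) hd2 hne hAP hx hy).trans <| by
      gcongr
      exact (hdist x hx y hy).trans hδ
  have hf'' : ∀ x ∈ Icc lo hi, |f'' x| ≤ |f' m| * exp 1 := fun x hx => by
    have := hAP x hx
    rw [abs_div, div_le_one (abs_pos.2 (hne x hx))] at this
    exact this.trans (hexp x hx m hm)
  have hT1 : ∀ x ∈ Icc lo hi,
      |f x - f m - f' m * (x - m)| ≤ |f' m| * exp 1 / 2 * (x - m) ^ 2 := fun x hx =>
    abs_taylor_two_le (fun t ht => hd1 t (hsub x hx ht)) (fun t ht => hd2 t (hsub x hx ht))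
      (fun t ht => hf'' t (hsub x hx ht))
  have hT2 : ∀ x ∈ Icc lo hi,
      |f x - f m - f' m * (x - m) - f'' m / 2 * (x - m) ^ 2| ≤ L * d / 2 * (x - m) ^ 2 :=
    fun x hx => by
      have := abs_taylor_two_le (m := m) (x := x) (c := L * d)
        (h := fun t => f t - f'' m / 2 * (t - m) ^ 2)
        (h' := fun t => f' t - f'' m * (t - m)) (h'' := fun t => f'' t - f'' m)
        (fun t ht => ((hd1 t (hsub x hx ht)).sub
          ((((hasDerivAt_id t).sub_const m).pow 2).const_mul (f'' m / 2))).congr_deriv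
            (by simp; ring))
        (fun t ht => ((hd2 t (hsub x hx ht)).sub
          (((hasDerivAt_id t).sub_const m).const_mul (f'' m))).congr_deriv (by simp))
        (fun t ht => (hLip t (hsub x hx ht) m hm).trans <| by
          gcongr
          exact hdist t (hsub x hx ht) m hm)
      convert this using 2
      ring
  have hy : f q - f m = (∑ i, (f (a i) - f m - f' m * (a i - m))) / n := by
    rw [sum_sub_distrib, sum_sub_distrib, ← mul_sum, hcent, hq]
    simp
    field_simp
  have hy1 : |f q - f m| ≤ |f' m| * exp 1 / 2 * V := hy ▸ hsumb fun i => hT1 _ (ha i)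
  have hy2 : |f q - f m - f'' m / 2 * V| ≤ L * d / 2 * V := by
    have := hsumb fun i => hT2 _ (ha i)
    rwa [sum_sub_distrib, sub_div, ← hy, ← mul_sum, mul_div_assoc, ← hVdef] at this
  have hqm : |q - m| ≤ exp 1 ^ 2 / 2 * V := by
    have hmv : |f' m| * |q - m| ≤ exp 1 * |f q - f m| := by
      rcases eq_or_ne m q with rfl | hmq
      · simp
      have hinter : ∃ ξ ∈ Icc lo hi, f q - f m = f' ξ * (q - m) := by
        rcases lt_or_gt_of_ne hmq with h | h
        · have hs : Icc m q ⊆ Icc lo hi := Icc_subset_Icc hm.1 hqJ.2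
          obtain ⟨ξ, hξ, e⟩ := exists_hasDerivAt_eq_slope f f' h
            (fun t ht => (hd1 t (hs ht)).continuousAt.continuousWithinAt)
            (fun t ht => hd1 t (hs (Ioo_subset_Icc_self ht)))
          refine ⟨ξ, hs (Ioo_subset_Icc_self hξ), ?_⟩
          rw [e, div_mul_cancel₀ _ (sub_ne_zero.2 h.ne')]
        · have hs : Icc q m ⊆ Icc lo hi := Icc_subset_Icc hqJ.1 hm.2
          obtain ⟨ξ, hξ, e⟩ := exists_hasDerivAt_eq_slope f f' h
            (fun t ht => (hd1 t (hs ht)).continuousAt.continuousWithinAt)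
            (fun t ht => hd1 t (hs (Ioo_subset_Icc_self ht)))
          refine ⟨ξ, hs (Ioo_subset_Icc_self hξ), ?_⟩
          have h0 : m - q ≠ 0 := sub_ne_zero.2 h.ne'
          rw [e]
          field_simp
          ring
      obtain ⟨ξ, hξ, e⟩ := hinter
      rw [e, abs_mul, ← mul_assoc, mul_comm (exp 1)]
      gcongr
      exact hexp m hm ξ hξ
    refine le_of_mul_le_mul_left (hmv.trans ?_) hD
    calc _ ≤ exp 1 * (|f' m| * exp 1 / 2 * V) := by gcongr
      _ = _ := by ring
  have hrem : |f' m * (q - m) - f'' m / 2 * V| ≤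
      |f' m| * exp 1 / 2 * (exp 1 ^ 2 / 2 * V) ^ 2 + L * d / 2 * V := by
    have h1 := (hT1 q hqJ).trans (b := |f' m| * exp 1 / 2 * (q - m) ^ 2)
      (c := |f' m| * exp 1 / 2 * (exp 1 ^ 2 / 2 * V) ^ 2) (by rw [← sq_abs (q - m)]; gcongr)
    rw [abs_sub_comm] at h1
    refine le_trans ?_ ((abs_add_le _ _).trans (add_le_add h1 hy2))
    apply le_of_eq
    congr 1
    ring
  have hVV : V ^ 2 ≤ d * V := by
    have : V ≤ d := by nlinarith
    nlinarith
  refine le_of_mul_le_mul_left ?_ hD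
  rw [← abs_mul]
  calc _ = |f' m * (q - m) - f'' m / 2 * V| := by
        congr 1
        field_simp [hne m hm]
    _ ≤ |f' m| * exp 1 / 2 * (exp 1 ^ 2 / 2 * V) ^ 2 + L * d / 2 * V := hrem
    _ = |f' m| * exp 1 ^ 5 / 8 * V ^ 2 + L * d / 2 * V := by ring
    _ ≤ |f' m| * exp 1 ^ 5 / 8 * (d * V) + L * d / 2 * V := by gcongr
    _ = _ := by field_simp; ring

/-- Perturbation bound for the variance of `A / 2` when `|A| ≤ 1`. -/
theorem abs_varV_half_add_sub_le {n : ℕ} (hn : 0 < n) {A F c : Fin n → ℝ} {d : ℝ}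
    (hA : ∀ k, |A k| ≤ 1) (hF : ∀ k, |F k| ≤ c k * d) :
    |varV (fun k => 1 / 2 * A k + F k) - 1 / 4 * varV A| ≤
      2 * amean c * d + amean (fun k => c k ^ 2) * d ^ 2 := by
  have hn' : (0 : ℝ) < n := by positivity
  have hAm : |amean A| ≤ 1 := abs_le.2 <|
    div_card_mem_of_forall_mem hn (convex_Icc (-1 : ℝ) 1) fun k => abs_le.1 (hA k)
  have hmean : amean (fun k => 1 / 2 * A k + F k) = 1 / 2 * amean A + amean F := by
    simp only [amean, sum_add_distrib, ← mul_sum]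
    ring
  have hAc := sum_sub_amean hn A
  have hFc := sum_sub_amean hn F
  have hsplit : varV (fun k => 1 / 2 * A k + F k) - 1 / 4 * varV A =
      (∑ k, (A k - amean A) * F k) / n + varV F := by
    have : ∑ k, (A k - amean A) * F k = ∑ k, (A k - amean A) * (F k - amean F) := by
      simp only [mul_sub, sum_sub_distrib (f := fun k => (A k - amean A) * F k), ← sum_mul, hAc,
        zero_mul, sub_zero]
    rw [this]
    simp only [varV, hmean]
    rw [← mul_div_assoc, ← sub_div, ← add_div, mul_sum, ← sum_sub_distrib, ← sum_add_distrib]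
    congr 1
    exact sum_congr rfl fun k _ => by ring
  have hcov : |(∑ k, (A k - amean A) * F k) / n| ≤ 2 * amean c * d := by
    rw [abs_div, abs_of_pos hn', div_le_iff₀ hn']
    calc _ ≤ ∑ k, 2 * (c k * d) := (abs_sum_le_sum_abs _ _).trans <| sum_le_sum fun k _ => by
          rw [abs_mul]
          gcongr
          · exact (abs_sub _ _).trans (by linarith [hA k])
          · exact hF k
      _ = _ := by
          simp only [← mul_sum, ← sum_mul, amean]
          field_simp
  have hvar : varV F ≤ amean (fun k => c k ^ 2) * d ^ 2 := by
    have h : ∑ k, (F k - amean F) ^ 2 ≤ ∑ k, F k ^ 2 := by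
      have e : ∑ k, F k ^ 2 =
          ∑ k, (F k - amean F) ^ 2 + 2 * amean F * ∑ k, (F k - amean F) + n * amean F ^ 2 := by
        rw [mul_sum, ← sum_add_distrib]
        have : (n : ℝ) * amean F ^ 2 = ∑ _k : Fin n, amean F ^ 2 := by simp
        rw [this, ← sum_add_distrib]
        exact sum_congr rfl fun k _ => by ring
      rw [e, hFc]
      nlinarith [mul_nonneg hn'.le (sq_nonneg (amean F))]
    rw [varV, amean.eq_def fun k => c k ^ 2, div_mul_eq_mul_div]
    gcongr
    refine h.trans ?_
    rw [sum_mul]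
    refine sum_le_sum fun k _ => ?_
    rw [← mul_pow, ← sq_abs]
    exact pow_le_pow_left₀ (abs_nonneg _) (hF k) 2
  rw [hsplit]
  refine (abs_add_le _ _).trans (add_le_add hcov ?_)
  rwa [abs_of_nonneg (varV_nonneg F)]

theorem varV_add_mul {n : ℕ} (hn : 0 < n) (b : Fin n → ℝ) (m v : ℝ) :
    varV (fun k => m + v * b k) = v ^ 2 * varV b := by
  have hmean : amean (fun k => m + v * b k) = m + v * amean b := by
    have : (n : ℝ) ≠ 0 := by positivity
    simp only [amean, sum_add_distrib, ← mul_sum]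
    simp
    field_simp
  simp only [varV, hmean]
  rw [← mul_div_assoc, mul_sum]
  congr 1
  exact sum_congr rfl fun k _ => by ring

theorem exp_one_pow_five_div_le :
    exp 1 ^ 5 / 8 ≤ ((3 + 7 * exp 1) / 3) ^ 2 * exp 1 / 4 := by
  have h0 := exp_pos 1
  have h1 : exp 1 ≤ 3 := by linarith [exp_one_lt_d9]
  have h2 : exp 1 ^ 2 ≤ 3 * exp 1 := by nlinarith
  have h3 : exp 1 ^ 4 ≤ 9 * exp 1 ^ 2 := by nlinarith
  have h4 : exp 1 ^ 4 / 2 ≤ ((3 + 7 * exp 1) / 3) ^ 2 := by nlinarith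
  nlinarith [mul_le_mul_of_nonneg_right h4 h0.le]

theorem var_ratio_estimate
    (I : Set ℝ) (hI : I.OrdConnected) (n : ℕ) (hn : 0 < n)
    (f f' f'' : Fin n → ℝ → ℝ) (L : Fin n → ℝ) (hL : ∀ k, 0 ≤ L k)
    (hd1 : ∀ k, ∀ x ∈ I, HasDerivAt (f k) (f' k x) x)
    (hd2 : ∀ k, ∀ x ∈ I, HasDerivAt (f' k) (f'' k x) x)
    (hc : ∀ k, ContinuousOn (f'' k) I)
    (hne : ∀ k, ∀ x ∈ I, f' k x ≠ 0)
    (hLip : ∀ k, ∀ x ∈ I, ∀ y ∈ I, |f'' k x - f'' k y| ≤ L k * |x - y|)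
    (hAP : ∀ k, ∀ x ∈ I, |f'' k x / f' k x| ≤ 1)
    (a : Fin n → ℝ) (ha : ∀ i, a i ∈ I)
    (hnc : ∃ i j, a i ≠ a j) (hδ : deltaV a < 1)
    -- Q k is the quasi-arithmetic mean QA_{f_k}(a), so that Q = M_f(a):
    (Q : Fin n → ℝ) (hQI : ∀ k, Q k ∈ I)
    (hQ : ∀ k, f k (Q k) = (∑ i, f k (a i)) / n) :
    |varV Q / varV a ^ 2
        - 1 / 4 * varV (fun j => f'' j (amean a) / f' j (amean a))|
      ≤ 16 * n ^ 2 * (amean (fun k => L k / (2 * |f' k (amean a)|)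
            + ((3 + 7 * Real.exp 1) / 3) ^ 2 * Real.exp 1 / 4)) * deltaV a
        + 4 * n ^ 2 * (3 * (amean (fun k => L k / (2 * |f' k (amean a)|)
            + ((3 + 7 * Real.exp 1) / 3) ^ 2 * Real.exp 1 / 4)) ^ 2
          + amean (fun k => (L k / (2 * |f' k (amean a)|)
            + ((3 + 7 * Real.exp 1) / 3) ^ 2 * Real.exp 1 / 4) ^ 2)) * deltaV a ^ 2 := by
  have : Nonempty (Fin n) := ⟨⟨0, hn⟩⟩
  have hfin := Set.finite_range a
  have hrange := Set.range_nonempty a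
  have hrI : Set.range a ⊆ I := Set.range_subset_iff.2 ha
  have hlo : sInf (Set.range a) ∈ I := hrI (hrange.csInf_mem hfin)
  have hhi : sSup (Set.range a) ∈ I := hrI (hrange.csSup_mem hfin)
  have haJ : ∀ i, a i ∈ Icc (sInf (Set.range a)) (sSup (Set.range a)) := fun i =>
    ⟨csInf_le hfin.bddBelow ⟨i, rfl⟩, le_csSup hfin.bddAbove ⟨i, rfl⟩⟩
  have hJ : Icc (sInf (Set.range a)) (sSup (Set.range a)) ⊆ I := hI.out hlo hhi
  have hmI : amean a ∈ I := hJ (div_card_mem_of_forall_mem hn (convex_Icc _ _) haJ)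
  have hδ0 : 0 ≤ deltaV a := sub_nonneg.2 ((haJ ⟨0, hn⟩).1.trans (haJ ⟨0, hn⟩).2)
  have hV : 0 < varV a := varV_pos hn hnc
  set c : Fin n → ℝ := fun k => L k / (2 * |f' k (amean a)|)
    + ((3 + 7 * Real.exp 1) / 3) ^ 2 * Real.exp 1 / 4 with hc_def
  have hc0 : ∀ k, 0 ≤ c k := fun k => by
    have := hL k
    simp only [hc_def]
    positivity
  set A : Fin n → ℝ := fun k => f'' k (amean a) / f' k (amean a)
  set F : Fin n → ℝ := fun k => (Q k - amean a - 1 / 2 * A k * varV a) / varV a with hF_def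
  have hF : ∀ k, |F k| ≤ c k * deltaV a := fun k => by
    have hQJ := quasiArithMean_mem_Icc hn hI (hd1 k) (hne k) hlo hhi haJ (hQI k) (hQ k)
    have h := abs_quasiArithMean_sub_le hn (hL k) (fun x hx => hd1 k x (hJ hx))
      (fun x hx => hd2 k x (hJ hx)) (fun x hx => hne k x (hJ hx))
      (fun x hx y hy => hLip k x (hJ hx) y (hJ hy)) (fun x hx => hAP k x (hJ hx))
      haJ hδ.le hQJ (hQ k)
    rw [hF_def, abs_div, abs_of_pos hV, div_le_iff₀ hV]
    refine h.trans ?_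
    have hδ_eq : sSup (Set.range a) - sInf (Set.range a) = deltaV a := rfl
    rw [hδ_eq]
    gcongr
    exact add_le_add_right exp_one_pow_five_div_le _
  have hQF : Q = fun k => amean a + varV a * (1 / 2 * A k + F k) := funext fun k => by
    simp only [hF_def]
    field_simp
    ring
  have hratio : varV Q / varV a ^ 2 = varV (fun k => 1 / 2 * A k + F k) := by
    conv_lhs => rw [hQF, varV_add_mul hn]
    field_simp
  rw [hratio]
  refine (abs_varV_half_add_sub_le hn (fun k => hAP k _ hmI) hF).trans ?_
  have hn1 : (1 : ℝ) ≤ (n : ℝ) ^ 2 := one_le_pow₀ (by exact_mod_cast hn)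
  have hC : 0 ≤ amean c := div_nonneg (sum_nonneg fun k _ => hc0 k) n.cast_nonneg
  have hC2 : 0 ≤ amean (fun k => c k ^ 2) :=
    div_nonneg (sum_nonneg fun k _ => sq_nonneg _) n.cast_nonneg
  gcongr
  · linarith
  · nlinarith [mul_nonneg (by positivity : (0 : ℝ) ≤ (n : ℝ) ^ 2) (sq_nonneg (amean c)),
      mul_nonneg (sub_nonneg.2 hn1) hC2]
end
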